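/- Order the eigenspaces of A as V_0, V_1, …, V_{2N}, where V_k is the eigenspace of A for θ_k for 0 ≤ k ≤ N, and V_{N+k} is the eigenspace of A for θ_{k−1/2} for 1 ≤ k ≤ N. Then A* is a dual adjacency matrix for this ordering: (a) the unital ℂ-subalgebra of Mat_X(ℂ) generated by A* equals the span of E*_0, …, E*_N; and (b) A* V_k ⊆ V_{k−1} + V_k + V_{k+1} for 0 ≤ k ≤ 2N, where V_{−1} = 0 and V_{2N+1} = 0. In particular, this ordering of the eigenspaces of A is Q-polynomial, so the q-adjacency matrix A is Q-polynomial. -/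

import Mathlib

open Module Matrix Finset

noncomputable section

open scoped Classical

variable {F H : Type} [Field F] [Fintype F] [AddCommGroup H] [Module F H]
  [FiniteDimensional F H]

/-- The vertex set of the Attenuated Space poset `A_q(N,M)`:
the subspaces of `H` that intersect `h` trivially. -/
def AttX (h : Submodule F H) := {y : Submodule F H // y ⊓ h = ⊥}

instance (h : Submodule F H) : Fintype (AttX h) := by
  have : Finite H := Module.finite_of_finite F
  have : Finite (Submodule F H) :=
    Finite.of_injective (fun y : Submodule F H => (y : Set H)) SetLike.coe_injective
  have : Finite (AttX h) := Subtype.finite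
  exact Fintype.ofFinite _

/-- The dimension of a vertex. -/
def vdim (h : Submodule F H) (y : AttX h) : ℕ := finrank F (y.1 : Submodule F H)

/-- `AttCovers h y z` means that `z` covers `y`: `y ⊆ z` and `dim z = dim y + 1`. -/
def AttCovers (h : Submodule F H) (y z : AttX h) : Prop :=
  y.1 ≤ z.1 ∧ vdim h z = vdim h y + 1

/-- The raising matrix `R`: `(y,z)`-entry `1` if `y` covers `z`, else `0`. -/
def Rmat (h : Submodule F H) : Matrix (AttX h) (AttX h) ℂ :=
  fun y z => if AttCovers h z y then 1 else 0

/-- The lowering matrix `L'`: `(y,z)`-entry `1` if `z` covers `y`, else `0`. -/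
def Lpmat (h : Submodule F H) : Matrix (AttX h) (AttX h) ℂ :=
  fun y z => if AttCovers h y z then 1 else 0

/-- The `q`-lowering matrix `L`: `(y,z)`-entry `q^(dim y)` if `z` covers `y`, else `0`. -/
def Lmat (h : Submodule F H) (q : ℕ) : Matrix (AttX h) (AttX h) ℂ :=
  fun y z => if AttCovers h y z then (q : ℂ) ^ (vdim h y) else 0

/-- The `q`-adjacency matrix `A`: `(y,z)`-entry `1` if `y` covers `z`,
`q^(dim y)` if `z` covers `y`, and `0` otherwise. -/
def Amat (h : Submodule F H) (q : ℕ) : Matrix (AttX h) (AttX h) ℂ :=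
  fun y z =>
    if AttCovers h z y then 1 else if AttCovers h y z then (q : ℂ) ^ (vdim h y) else 0

/-- The dual adjacency matrix `A*`: diagonal with `(y,y)`-entry `q^{-dim y}`. -/
def Astar (h : Submodule F H) (q : ℕ) : Matrix (AttX h) (AttX h) ℂ :=
  Matrix.diagonal fun y => (q : ℂ) ^ (-(vdim h y : ℤ))

/-- The matrix `S`: diagonal with `(y,y)`-entry `(-1)^(dim y)`. -/
def Smat (h : Submodule F H) : Matrix (AttX h) (AttX h) ℂ :=
  Matrix.diagonal fun y => (-1 : ℂ) ^ (vdim h y)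

/-- The matrix `E*_i`: diagonal with `(y,y)`-entry `1` if `dim y = i`, else `0`. -/
def Estar (h : Submodule F H) (i : ℕ) : Matrix (AttX h) (AttX h) ℂ :=
  Matrix.diagonal fun y => if vdim h y = i then (1 : ℂ) else 0

/-- The eigenvalue `θ_i` for `i = k/2 ∈ [N] = {0, 1/2, 1, …, N}` (so `k = 0,…,2N`):
`θ_i = (q^(N-i) - q^i)/(q - 1) · q^(M/2)`, written via `√q`. -/
def theta (q N M k : ℕ) : ℝ :=
  (Real.sqrt q ^ (2 * N - k) - Real.sqrt q ^ k) / ((q : ℝ) - 1) * Real.sqrt q ^ M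

/-- The eigenspace of the `q`-adjacency matrix `A` for the eigenvalue `θ_{k/2}`. -/
def eigA (h : Submodule F H) (q N M k : ℕ) : Submodule ℂ (AttX h → ℂ) :=
  Module.End.eigenspace (Matrix.toLin' (Amat h q)) ((theta q N M k : ℝ) : ℂ)

/-- The ordering `V_0, …, V_(2N)` of the eigenspaces of `A`: for `0 ≤ k ≤ N`, `V_k` is the
eigenspace for `θ_k` (doubled index `2k`); for `N < k ≤ 2N`, `V_k` is the eigenspace for
`θ_(k-N-1/2)` (doubled index `2(k-N) - 1`); and `V_k = 0` for `k` out of range. -/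
def Vord (h : Submodule F H) (q N M : ℕ) (k : ℤ) : Submodule ℂ (AttX h → ℂ) :=
  if 0 ≤ k ∧ k ≤ (N : ℤ) then eigA h q N M (2 * k.toNat)
  else if (N : ℤ) < k ∧ k ≤ 2 * (N : ℤ) then eigA h q N M (2 * (k.toNat - N) - 1)
  else ⊥

set_option linter.unusedSectionVars false

section Counting

variable {q : ℕ} {h : Submodule F H}

theorem one_lt_of_card_eq (hq : Fintype.card F = q) : 1 < q :=
  hq ▸ Fintype.one_lt_card

theorem AttX.eq_of_le_of_vdim_le {y z : AttX h} (hyz : y.1 ≤ z.1) (hd : vdim h z ≤ vdim h y) :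
    y = z :=
  Subtype.ext (Submodule.eq_of_le_of_finrank_le hyz hd)

/-- A subspace of a vertex is a vertex. -/
def AttX.ofLE (y : AttX h) (p : Submodule F H) (hp : p ≤ y.1) : AttX h :=
  ⟨p, le_bot_iff.1 ((inf_le_inf_right h hp).trans y.2.le)⟩

theorem sup_span_singleton_eq_of_covers {p c : Submodule F H} (hpc : p ≤ c)
    (hd : finrank F c = finrank F p + 1) {v : H} (hv : v ∈ c) (hvp : v ∉ p) :
    p ⊔ Submodule.span F {v} = c := by
  refine Submodule.eq_of_le_of_finrank_le (sup_le hpc ?_) ?_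
  · simpa using hv
  · rw [hd, Submodule.finrank_sup_span_singleton hvp]

theorem card_submodule (hq : Fintype.card F = q) (p : Submodule F H) :
    Nat.card p = q ^ finrank F p := by
  rw [Module.natCard_eq_pow_finrank (K := F), Nat.card_eq_fintype_card, hq]

theorem ncard_diff_submodule (hq : Fintype.card F = q) {p c : Submodule F H} (hpc : p ≤ c) :
    ((c : Set H) \ p).ncard = q ^ finrank F c - q ^ finrank F p := by
  have : Finite H := Module.finite_of_finite F
  rw [Set.ncard_sdiff hpc, ← card_submodule hq, ← card_submodule hq]
  rfl

theorem finrank_sup_inf_eq (p : AttX h) (T : Submodule F H) :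
    finrank F (p.1 ⊔ T ⊓ h : Submodule F H) = vdim h p + finrank F (T ⊓ h : Submodule F H) := by
  have h1 := Submodule.finrank_sup_add_finrank_inf_eq p.1 (T ⊓ h)
  have h2 : p.1 ⊓ (T ⊓ h) = ⊥ :=
    le_bot_iff.1 ((inf_le_inf_left _ inf_le_right).trans p.2.le)
  rw [h2, finrank_bot] at h1
  simpa [vdim] using h1

theorem iUnion_covers_diff (p : AttX h) {T : Submodule F H} (hpT : p.1 ≤ T) :
    (⋃ c ∈ (univ.filter fun c : AttX h => AttCovers h p c ∧ c.1 ≤ T), ((c.1 : Set H) \ p.1)) =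
      (T : Set H) \ (p.1 ⊔ T ⊓ h : Submodule F H) := by
  ext v
  simp only [mem_filter, mem_univ, true_and, Set.mem_iUnion, Set.mem_sdiff, SetLike.mem_coe,
    exists_prop]
  constructor
  · rintro ⟨c, ⟨hpc, hcT⟩, hvc, hvp⟩
    refine ⟨hcT hvc, fun hv => hvp ?_⟩
    obtain ⟨a, ha, b, hb, rfl⟩ := Submodule.mem_sup.1 hv
    have hbc : b ∈ c.1 := by
      simpa using sub_mem hvc (hpc.1 ha)
    have hb0 : b ∈ c.1 ⊓ h := ⟨hbc, hb.2⟩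
    rw [c.2, Submodule.mem_bot] at hb0
    simpa [hb0] using ha
  · rintro ⟨hvT, hv⟩
    have hvp : v ∉ p.1 := fun hvp => hv (Submodule.mem_sup_left hvp)
    have hc : (p.1 ⊔ Submodule.span F {v}) ⊓ h = ⊥ := by
      refine le_bot_iff.1 fun w hw => ?_
      obtain ⟨a, ha, b, hb, rfl⟩ := Submodule.mem_sup.1 hw.1
      obtain ⟨t, rfl⟩ := Submodule.mem_span_singleton.1 hb
      by_cases ht : t = 0
      · have : a ∈ p.1 ⊓ h := ⟨ha, by simpa [ht] using hw.2⟩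
        rw [p.2] at this
        simpa [ht] using this
      · refine absurd ?_ hv
        refine Submodule.mem_sup.2 ⟨-(t⁻¹ • a), neg_mem (p.1.smul_mem _ ha),
          t⁻¹ • (a + t • v), ⟨T.smul_mem _ (T.add_mem (hpT ha) (T.smul_mem _ hvT)),
            h.smul_mem _ hw.2⟩, ?_⟩
        rw [smul_add, smul_smul, inv_mul_cancel₀ ht]
        simp
    refine ⟨⟨_, hc⟩, ⟨⟨le_sup_left, ?_⟩, sup_le hpT (by simpa using hvT)⟩, ?_, hvp⟩
    · exact Submodule.finrank_sup_span_singleton hvp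
    · exact Submodule.mem_sup_right (Submodule.mem_span_singleton_self v)

theorem card_covers_le (hq : Fintype.card F = q) (p : AttX h) {T : Submodule F H}
    (hpT : p.1 ≤ T) :
    (∑ c : AttX h, if AttCovers h p c ∧ c.1 ≤ T then (1 : ℂ) else 0) * ((q : ℂ) - 1) =
      (q : ℂ) ^ (finrank F T - vdim h p) - (q : ℂ) ^ finrank F (T ⊓ h : Submodule F H) := by
  have : Finite H := Module.finite_of_finite F
  have hq1 := one_lt_of_card_eq hq
  set C := univ.filter fun c : AttX h => AttCovers h p c ∧ c.1 ≤ T with hC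
  have hle : p.1 ⊔ T ⊓ h ≤ T := sup_le hpT inf_le_left
  have hdis : ((C : Set (AttX h))).PairwiseDisjoint fun c => ((c.1 : Set H) \ p.1) := by
    intro c hc c' hc' hne
    refine Set.disjoint_left.2 fun v hv hv' => hne ?_
    simp only [hC, coe_filter, mem_univ, true_and, Set.mem_ofPred_eq] at hc hc'
    exact Subtype.ext ((sup_span_singleton_eq_of_covers hc.1.1 hc.1.2 hv.1 hv.2).symm.trans
      (sup_span_singleton_eq_of_covers hc'.1.1 hc'.1.2 hv'.1 hv'.2))
  have hcard : C.card * (q ^ (vdim h p + 1) - q ^ vdim h p) =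
      q ^ finrank F T - q ^ (vdim h p + finrank F (T ⊓ h : Submodule F H)) := by
    rw [← finrank_sup_inf_eq, ← ncard_diff_submodule hq hle, ← iUnion_covers_diff p hpT]
    have hsum := Set.Finite.ncard_biUnion C.finite_toSet (fun c _ => Set.toFinite _) hdis
    rw [finsum_mem_coe_finset] at hsum
    refine Eq.trans ?_ hsum.symm
    rw [sum_const_nat (m := q ^ (vdim h p + 1) - q ^ vdim h p)]
    intro c hc
    have hc' := (mem_filter.1 hc).2.1
    rw [ncard_diff_submodule hq hc'.1, ← hc'.2]
    rfl
  have hd : vdim h p ≤ finrank F T := Submodule.finrank_mono hpT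
  have hd' := finrank_sup_inf_eq p T ▸ Submodule.finrank_mono hle
  have hq0 : (q : ℂ) ≠ 0 := by exact_mod_cast (by omega : q ≠ 0)
  have hcard' := congrArg (Nat.cast : ℕ → ℂ) hcard
  rw [Nat.cast_mul, Nat.cast_sub (Nat.pow_le_pow_right (by omega) (by omega)),
    Nat.cast_sub (Nat.pow_le_pow_right (by omega) hd')] at hcard'
  push_cast at hcard'
  have hsum : (∑ c : AttX h, if AttCovers h p c ∧ c.1 ≤ T then (1 : ℂ) else 0) = C.card := by
    simp [hC]
  rw [hsum]
  refine mul_left_cancel₀ (pow_ne_zero (vdim h p) hq0) ?_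
  have hpow := pow_add (q : ℂ) (vdim h p) (finrank F T - vdim h p)
  rw [Nat.add_sub_cancel' hd] at hpow
  linear_combination hcard' + hpow

end Counting

section Sums

variable {q N M : ℕ} {h : Submodule F H}

theorem Lpmat_of_covers {a b : AttX h} (hab : AttCovers h a b) : Lpmat h a b = 1 := if_pos hab

theorem Lpmat_of_not_covers {a b : AttX h} (hab : ¬ AttCovers h a b) : Lpmat h a b = 0 :=
  if_neg hab

theorem covers_of_Lpmat_ne_zero {a b : AttX h} (hab : Lpmat h a b ≠ 0) : AttCovers h a b := by
  by_contra hn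
  exact hab (if_neg hn)

theorem Lpmat_mul_self (a b : AttX h) : Lpmat h a b * Lpmat h a b = Lpmat h a b := by
  by_cases hab : AttCovers h a b <;> simp [Lpmat, hab]

/-- Two elements below `T` covering `p` and covered by a vertex two steps above `p`. -/
theorem sum_between (hq : Fintype.card F = q) {a y : AttX h} (hay : a.1 ≤ y.1)
    (hd : vdim h y = vdim h a + 2) : ∑ b, Lpmat h a b * Lpmat h b y = (q : ℂ) + 1 := by
  have hq1 : (q : ℂ) - 1 ≠ 0 :=
    sub_ne_zero.2 (by exact_mod_cast (one_lt_of_card_eq hq).ne')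
  have hU := card_covers_le hq a hay
  have hsum : ∑ b, Lpmat h a b * Lpmat h b y =
      ∑ c : AttX h, if AttCovers h a c ∧ c.1 ≤ y.1 then (1 : ℂ) else 0 := by
    refine sum_congr rfl fun b _ => ?_
    by_cases hab : AttCovers h a b
    · have : AttCovers h b y ↔ b.1 ≤ y.1 := ⟨fun hb => hb.1, fun hb => ⟨hb, by have := hab.2; omega⟩⟩
      simp [Lpmat, hab, this]
    · simp [Lpmat, hab]
  have hy : finrank F y.1 = vdim h a + 2 := hd
  rw [y.2, finrank_bot, hy, Nat.add_sub_cancel_left] at hU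
  rw [hsum]
  refine mul_right_cancel₀ hq1 (hU.trans (by ring))

theorem sum_between_of_not_le {a y : AttX h} (hay : ¬ a.1 ≤ y.1) :
    ∑ b, Lpmat h a b * Lpmat h b y = 0 := by
  refine sum_eq_zero fun b _ => ?_
  by_contra hne
  exact hay ((covers_of_Lpmat_ne_zero (left_ne_zero_of_mul hne)).1.trans
    (covers_of_Lpmat_ne_zero (right_ne_zero_of_mul hne)).1)

/-- Distinct vertices covering a common vertex cover no other common vertex. -/
theorem sum_lower_common {a y z : AttX h} (hne : a ≠ y) (hza : AttCovers h z a)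
    (hzy : AttCovers h z y) : ∑ b, Lpmat h b a * Lpmat h b y = 1 := by
  have key : ∀ b : AttX h, AttCovers h b a → AttCovers h b y → b = z := by
    intro b hba hby
    have hlt : vdim h (a.ofLE (a.1 ⊓ y.1) inf_le_left) < vdim h a := by
      refine lt_of_not_ge fun hge => hne ?_
      have h1 := AttX.eq_of_le_of_vdim_le (y := a.ofLE (a.1 ⊓ y.1) inf_le_left) inf_le_left hge
      have h2 : a.1 ≤ y.1 := inf_eq_left.1 (Subtype.ext_iff.1 h1)
      exact AttX.eq_of_le_of_vdim_le h2 (by have := hza.2; have := hzy.2; omega)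
    have hb : b = a.ofLE (a.1 ⊓ y.1) inf_le_left :=
      AttX.eq_of_le_of_vdim_le (le_inf hba.1 hby.1) (by have := hba.2; omega)
    have hz : z = a.ofLE (a.1 ⊓ y.1) inf_le_left :=
      AttX.eq_of_le_of_vdim_le (le_inf hza.1 hzy.1) (by have := hza.2; omega)
    rw [hb, ← hz]
  rw [sum_eq_single z, Lpmat_of_covers hza, Lpmat_of_covers hzy, mul_one]
  · intro b _ hbz
    by_contra hne
    exact hbz (key b (covers_of_Lpmat_ne_zero (left_ne_zero_of_mul hne))
      (covers_of_Lpmat_ne_zero (right_ne_zero_of_mul hne)))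
  · simp

theorem finrank_sup_add_finrank_inf (a b : AttX h) :
    finrank F (a.1 ⊔ b.1 : Submodule F H) + vdim h (a.ofLE (a.1 ⊓ b.1) inf_le_left) =
      vdim h a + vdim h b :=
  Submodule.finrank_sup_add_finrank_inf_eq a.1 b.1

/-- Distinct vertices with a common cover both cover their intersection. -/
theorem covers_inf_of_covers {b y a : AttX h} (hne : b ≠ y) (hba : AttCovers h b a)
    (hya : AttCovers h y a) :
    AttCovers h (b.ofLE (b.1 ⊓ y.1) inf_le_left) b ∧
      AttCovers h (b.ofLE (b.1 ⊓ y.1) inf_le_left) y := by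
  have hsum := finrank_sup_add_finrank_inf b y
  have hle : finrank F (b.1 ⊔ y.1 : Submodule F H) ≤ vdim h a :=
    Submodule.finrank_mono (sup_le hba.1 hya.1)
  have hlt : vdim h (b.ofLE (b.1 ⊓ y.1) inf_le_left) < vdim h b := by
    refine lt_of_not_ge fun hge => hne ?_
    have h1 := AttX.eq_of_le_of_vdim_le (y := b.ofLE (b.1 ⊓ y.1) inf_le_left) inf_le_left hge
    have h2 : b.1 ≤ y.1 := inf_eq_left.1 (Subtype.ext_iff.1 h1)
    exact AttX.eq_of_le_of_vdim_le h2 (by have := hba.2; have := hya.2; omega)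
  have h1 := hba.2
  have h2 := hya.2
  exact ⟨⟨inf_le_left, by omega⟩, ⟨inf_le_right, by omega⟩⟩

theorem exists_covers {y : AttX h} (hy : 0 < vdim h y) : ∃ z, AttCovers h z y := by
  have key : ∀ k ≤ vdim h y, ∃ p ≤ y.1, finrank F p = k := by
    intro k
    induction k with
    | zero => exact fun _ => ⟨⊥, bot_le, finrank_bot F H⟩
    | succ k ih =>
      intro hk
      obtain ⟨p, hp, hpk⟩ := ih (by omega)
      have hlt : p < y.1 := lt_of_le_of_ne hp fun he => by
        have : finrank F p = vdim h y := by rw [he]; rfl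
        omega
      obtain ⟨v, hv, hvp⟩ := SetLike.exists_of_lt hlt
      refine ⟨p ⊔ Submodule.span F {v}, sup_le hp (by simpa using hv), ?_⟩
      rw [Submodule.finrank_sup_span_singleton hvp, hpk]
  obtain ⟨p, hp, hpk⟩ := key (vdim h y - 1) (by omega)
  refine ⟨y.ofLE p hp, hp, ?_⟩
  have : vdim h (y.ofLE p hp) = vdim h y - 1 := hpk
  omega

/-- The number of vertices covered by a vertex. -/
theorem sum_lower (hq : Fintype.card F = q) (y : AttX h) :
    (∑ b, Lpmat h b y) * ((q : ℂ) - 1) = (q : ℂ) ^ vdim h y - 1 := by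
  induction hd : vdim h y generalizing y with
  | zero =>
    rw [sum_eq_zero fun b _ => Lpmat_of_not_covers fun hb => by have := hb.2; omega]
    simp
  | succ d ih =>
    obtain ⟨z, hz⟩ := exists_covers (y := y) (by omega)
    have ihz := ih z (by have := hz.2; omega)
    have h1 : ∑ b, Lpmat h b y * ∑ a, Lpmat h a b * Lpmat h a z =
        ∑ b, Lpmat h b y - 1 + ∑ a, Lpmat h a z := by
      have h0 : ∀ b, Lpmat h b y * ∑ a, Lpmat h a b * Lpmat h a z =
          Lpmat h b y + if b = z then (∑ a, Lpmat h a z - 1) else 0 := by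
        intro b
        by_cases hby : AttCovers h b y
        · by_cases hbz : b = z
          · subst hbz
            simp [Lpmat_mul_self, Lpmat_of_covers hby]
          · obtain ⟨h3, h4⟩ := covers_inf_of_covers hbz hby hz
            rw [sum_lower_common hbz h3 h4]
            simp [hbz]
        · have hbz : b ≠ z := fun he => hby (he ▸ hz)
          simp [hbz, Lpmat_of_not_covers hby]
      simp only [h0, sum_add_distrib, sum_ite_eq', mem_univ, if_true]
      ring
    have h2 : ∑ b, Lpmat h b y * ∑ a, Lpmat h a b * Lpmat h a z =
        ((q : ℂ) + 1) * ∑ a, Lpmat h a z := by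
      have : ∑ b, Lpmat h b y * ∑ a, Lpmat h a b * Lpmat h a z =
          ∑ a, Lpmat h a z * ∑ b, Lpmat h a b * Lpmat h b y := by
        simp only [mul_sum]
        rw [sum_comm]
        exact sum_congr rfl fun _ _ => sum_congr rfl fun _ _ => by ring
      rw [this, mul_sum]
      refine sum_congr rfl fun a _ => ?_
      by_cases haz : AttCovers h a z
      · rw [sum_between hq (haz.1.trans hz.1) (by have := haz.2; have := hz.2; omega), mul_comm]
      · simp [Lpmat_of_not_covers haz]
    rw [pow_succ]
    linear_combination ((q : ℂ) - 1) * (h2 - h1) + (q : ℂ) * ihz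

/-- The number of vertices covering a vertex. -/
theorem sum_upper (hq : Fintype.card F = q) (hH : finrank F H = N + M) (hh : finrank F h = M)
    (y : AttX h) :
    (∑ c, Lpmat h y c) * ((q : ℂ) - 1) = (q : ℂ) ^ (N + M - vdim h y) - (q : ℂ) ^ M := by
  have hU := card_covers_le hq y (le_top : y.1 ≤ ⊤)
  rw [finrank_top, hH, top_inf_eq, hh] at hU
  rw [← hU]
  simp [Lpmat]

theorem vdim_le (hH : finrank F H = N + M) (hh : finrank F h = M) (y : AttX h) :
    vdim h y ≤ N := by
  have h1 := finrank_sup_inf_eq y (⊤ : Submodule F H)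
  rw [top_inf_eq, hh] at h1
  have h2 := Submodule.finrank_le (y.1 ⊔ h)
  omega

end Sums

section Identity

variable {q N M : ℕ} {h : Submodule F H}

/-- The three sums in the main identity, when `z` is covered by `y`. -/
theorem triple_sums_of_covers (hq : Fintype.card F = q) {y z : AttX h} (hzy : AttCovers h z y) :
    (∑ a, Lpmat h a z * ∑ b, Lpmat h a b * Lpmat h b y = ((q : ℂ) + 1) * ∑ a, Lpmat h a z) ∧
    (∑ a, Lpmat h z a * ∑ b, Lpmat h b a * Lpmat h b y =
      ∑ a, Lpmat h z a + (∑ b, Lpmat h b y - 1)) ∧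
    (∑ b, Lpmat h y b * ∑ a, Lpmat h z a * Lpmat h a b = ((q : ℂ) + 1) * ∑ b, Lpmat h y b) := by
  refine ⟨?_, ?_, ?_⟩
  · rw [mul_sum]
    refine sum_congr rfl fun a _ => ?_
    by_cases haz : AttCovers h a z
    · rw [sum_between hq (haz.1.trans hzy.1) (by have := haz.2; have := hzy.2; omega), mul_comm]
    · simp [Lpmat_of_not_covers haz]
  · have h0 : ∀ a, Lpmat h z a * ∑ b, Lpmat h b a * Lpmat h b y =
        Lpmat h z a + if a = y then (∑ b, Lpmat h b y - 1) else 0 := by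
      intro a
      by_cases hza : AttCovers h z a
      · by_cases hay : a = y
        · subst hay
          simp [Lpmat_mul_self, Lpmat_of_covers hza]
        · rw [sum_lower_common hay hza hzy]
          simp [hay]
      · have hay : a ≠ y := fun he => hza (he ▸ hzy)
        simp [hay, Lpmat_of_not_covers hza]
    simp only [h0, sum_add_distrib, sum_ite_eq', mem_univ, if_true]
  · rw [mul_sum]
    refine sum_congr rfl fun b _ => ?_
    by_cases hyb : AttCovers h y b
    · rw [sum_between hq (hzy.1.trans hyb.1) (by have := hyb.2; have := hzy.2; omega), mul_comm]
    · simp [Lpmat_of_not_covers hyb]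

section NotLe

variable {y z : AttX h}

theorem eq_inf_of_covers_of_le (hzy : ¬ z.1 ≤ y.1) {a : AttX h}
    (haz : AttCovers h a z) (hay : a.1 ≤ y.1) : a = y.ofLE (y.1 ⊓ z.1) inf_le_left := by
  refine AttX.eq_of_le_of_vdim_le (le_inf hay haz.1) ?_
  by_contra hlt
  have hz : y.ofLE (y.1 ⊓ z.1) inf_le_left = z :=
    AttX.eq_of_le_of_vdim_le inf_le_right (by have := haz.2; omega)
  exact hzy (inf_eq_right.1 (Subtype.ext_iff.1 hz))

/-- If `a` covers `z` and is joined to `y` by a vertex `b` covered by both, then `a ≤ y ⊔ z`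
and `b` is the intersection of `a` and `y`. -/
theorem of_covers_both (hzy : ¬ z.1 ≤ y.1) {a b : AttX h}
    (hza : AttCovers h z a) (hba : AttCovers h b a) (hby : AttCovers h b y) :
    a.1 ≤ y.1 ⊔ z.1 ∧ AttCovers h (z.ofLE (z.1 ⊓ b.1) inf_le_left) z ∧
      b = y.ofLE (y.1 ⊓ a.1) inf_le_left := by
  have hne : z ≠ b := fun he => hzy (he ▸ hby.1)
  have hcov := (covers_inf_of_covers hne hza hba).1
  have hsum := finrank_sup_add_finrank_inf z b
  have hsup : z.1 ⊔ b.1 = a.1 := by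
    refine Submodule.eq_of_le_of_finrank_le (sup_le hza.1 hba.1) ?_
    change vdim h a ≤ _
    have := hcov.2
    have := hba.2
    omega
  refine ⟨hsup ▸ sup_le le_sup_right (hby.1.trans le_sup_left), hcov, ?_⟩
  refine AttX.eq_of_le_of_vdim_le (le_inf hby.1 hba.1) ?_
  by_contra hlt
  have hy : y.ofLE (y.1 ⊓ a.1) inf_le_left = y :=
    AttX.eq_of_le_of_vdim_le inf_le_left (by have := hby.2; omega)
  have hya : y.1 ≤ a.1 := inf_eq_left.1 (Subtype.ext_iff.1 hy)
  have hya' : y = a := AttX.eq_of_le_of_vdim_le hya (by have := hba.2; have := hby.2; omega)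
  exact hzy (hya' ▸ hza.1)

theorem triple_sums_of_not_covers_inf (hd : vdim h y = vdim h z + 1) (hzy : ¬ z.1 ≤ y.1)
    (hD : ¬ AttCovers h (y.ofLE (y.1 ⊓ z.1) inf_le_left) z) :
    (∑ a, Lpmat h a z * ∑ b, Lpmat h a b * Lpmat h b y = 0) ∧
    (∑ a, Lpmat h z a * ∑ b, Lpmat h b a * Lpmat h b y = 0) ∧
    (∑ b, Lpmat h y b * ∑ a, Lpmat h z a * Lpmat h a b = 0) := by
  have hsum := finrank_sup_add_finrank_inf y z
  have hlt : vdim h (y.ofLE (y.1 ⊓ z.1) inf_le_left) < vdim h z := by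
    refine lt_of_not_ge fun hge => hzy ?_
    exact inf_eq_right.1 (Subtype.ext_iff.1
      (AttX.eq_of_le_of_vdim_le (y := y.ofLE (y.1 ⊓ z.1) inf_le_left) inf_le_right hge))
  have hD' : vdim h (y.ofLE (y.1 ⊓ z.1) inf_le_left) + 1 ≠ vdim h z :=
    fun he => hD ⟨inf_le_right, he.symm⟩
  refine ⟨sum_eq_zero fun a _ => ?_, sum_eq_zero fun a _ => ?_, sum_eq_zero fun b _ => ?_⟩
  · by_cases haz : AttCovers h a z
    · rw [sum_between_of_not_le, mul_zero]
      exact fun hay => hD (eq_inf_of_covers_of_le hzy haz hay ▸ haz)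
    · simp [Lpmat_of_not_covers haz]
  · rw [mul_sum]
    refine sum_eq_zero fun b _ => ?_
    by_contra hne
    have hza := covers_of_Lpmat_ne_zero (left_ne_zero_of_mul hne)
    have hba := covers_of_Lpmat_ne_zero (left_ne_zero_of_mul (right_ne_zero_of_mul hne))
    have hby := covers_of_Lpmat_ne_zero (right_ne_zero_of_mul (right_ne_zero_of_mul hne))
    obtain ⟨-, hcov, -⟩ := of_covers_both hzy hza hba hby
    exact hD (eq_inf_of_covers_of_le hzy hcov (inf_le_right.trans hby.1) ▸ hcov)
  · by_cases hyb : AttCovers h y b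
    · rw [sum_between_of_not_le, mul_zero]
      intro hzb
      have hle : finrank F (y.1 ⊔ z.1 : Submodule F H) ≤ vdim h b :=
        Submodule.finrank_mono (sup_le hyb.1 hzb)
      have := hyb.2
      omega
    · simp [Lpmat_of_not_covers hyb]

theorem sum_middle_of_covers_inf (hd : vdim h y = vdim h z + 1) (hzy : ¬ z.1 ≤ y.1)
    (hD : AttCovers h (y.ofLE (y.1 ⊓ z.1) inf_le_left) z) :
    ∑ a, Lpmat h z a * ∑ b, Lpmat h b a * Lpmat h b y =
      ∑ a : AttX h, if AttCovers h z a ∧ a.1 ≤ y.1 ⊔ z.1 then (1 : ℂ) else 0 := by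
  have hsum := finrank_sup_add_finrank_inf y z
  have hD2 := hD.2
  refine sum_congr rfl fun a _ => ?_
  by_cases hza : AttCovers h z a
  swap
  · simp [Lpmat_of_not_covers hza, hza]
  rw [Lpmat_of_covers hza, one_mul]
  by_cases ha : a.1 ≤ y.1 ⊔ z.1
  · rw [if_pos ⟨hza, ha⟩]
    have hsum' := finrank_sup_add_finrank_inf y a
    have hsup : y.1 ⊔ a.1 = y.1 ⊔ z.1 :=
      le_antisymm (sup_le le_sup_left ha) (sup_le_sup_left hza.1 _)
    rw [hsup] at hsum'
    have hza2 := hza.2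
    rw [sum_eq_single (y.ofLE (y.1 ⊓ a.1) inf_le_left)]
    · rw [Lpmat_of_covers ⟨inf_le_right, by omega⟩, Lpmat_of_covers ⟨inf_le_left, by omega⟩, mul_one]
    · intro b _ hb
      by_contra hne
      exact hb (of_covers_both hzy hza (covers_of_Lpmat_ne_zero (left_ne_zero_of_mul hne))
        (covers_of_Lpmat_ne_zero (right_ne_zero_of_mul hne))).2.2
    · simp
  · rw [if_neg fun h' => ha h'.2]
    refine sum_eq_zero fun b _ => ?_
    by_contra hne
    exact ha (of_covers_both hzy hza (covers_of_Lpmat_ne_zero (left_ne_zero_of_mul hne))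
      (covers_of_Lpmat_ne_zero (right_ne_zero_of_mul hne))).1

theorem sum_upper_of_covers_inf (hq : Fintype.card F = q) (hd : vdim h y = vdim h z + 1)
    (hD : AttCovers h (y.ofLE (y.1 ⊓ z.1) inf_le_left) z) :
    ∑ b, Lpmat h y b * ∑ a, Lpmat h z a * Lpmat h a b =
      if (y.1 ⊔ z.1) ⊓ h = ⊥ then (q : ℂ) + 1 else 0 := by
  have hsum := finrank_sup_add_finrank_inf y z
  have hD2 := hD.2
  split_ifs with hv
  · set v : AttX h := ⟨y.1 ⊔ z.1, hv⟩
    have hvd : vdim h v = finrank F (y.1 ⊔ z.1 : Submodule F H) := rfl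
    rw [sum_eq_single v]
    · rw [Lpmat_of_covers ⟨le_sup_left, by omega⟩, one_mul]
      exact sum_between hq le_sup_right (by omega)
    · intro b _ hb
      by_cases hyb : AttCovers h y b
      · rw [sum_between_of_not_le, mul_zero]
        refine fun hzb => hb (AttX.eq_of_le_of_vdim_le (sup_le hyb.1 hzb) ?_).symm
        have := hyb.2
        omega
      · simp [Lpmat_of_not_covers hyb]
    · simp
  · refine sum_eq_zero fun b _ => ?_
    by_cases hyb : AttCovers h y b
    · rw [sum_between_of_not_le, mul_zero]
      exact fun hzb => hv (b.ofLE _ (sup_le hyb.1 hzb)).2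
    · simp [Lpmat_of_not_covers hyb]

theorem sum_lower_of_covers_inf (hq : Fintype.card F = q) (hd : vdim h y = vdim h z + 1)
    (hzy : ¬ z.1 ≤ y.1) (hD : AttCovers h (y.ofLE (y.1 ⊓ z.1) inf_le_left) z) :
    ∑ a, Lpmat h a z * ∑ b, Lpmat h a b * Lpmat h b y = (q : ℂ) + 1 := by
  have hD2 := hD.2
  rw [sum_eq_single (y.ofLE (y.1 ⊓ z.1) inf_le_left)]
  · rw [Lpmat_of_covers hD, one_mul]
    exact sum_between hq inf_le_left (by omega)
  · intro a _ ha
    by_cases haz : AttCovers h a z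
    · rw [sum_between_of_not_le, mul_zero]
      exact fun hay => ha (eq_inf_of_covers_of_le hzy haz hay)
    · simp [Lpmat_of_not_covers haz]
  · simp

end NotLe

/-- The uniform-poset identity, entry by entry. -/
theorem triple_sum_identity (hq : Fintype.card F = q) (hH : finrank F H = N + M)
    (hh : finrank F h = M) {y z : AttX h} (hd : vdim h y = vdim h z + 1) :
    (q : ℂ) * (∑ a, Lpmat h a z * ∑ b, Lpmat h a b * Lpmat h b y) -
      ((q : ℂ) + 1) * (∑ a, Lpmat h z a * ∑ b, Lpmat h b a * Lpmat h b y) +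
      (∑ b, Lpmat h y b * ∑ a, Lpmat h z a * Lpmat h a b) =
    -((q : ℂ) + 1) * (q : ℂ) ^ (N + M - vdim h y) * Lpmat h z y := by
  have hq1 : (q : ℂ) - 1 ≠ 0 :=
    sub_ne_zero.2 (by exact_mod_cast (one_lt_of_card_eq hq).ne')
  by_cases hzy : z.1 ≤ y.1
  · have hcov : AttCovers h z y := ⟨hzy, hd⟩
    obtain ⟨h1, h2, h3⟩ := triple_sums_of_covers hq hcov
    rw [h1, h2, h3, Lpmat_of_covers hcov]
    refine mul_right_cancel₀ hq1 ?_
    have n1 := sum_lower hq z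
    have n2 := sum_lower hq y
    have n3 := sum_upper hq hH hh z
    have n4 := sum_upper hq hH hh y
    have hyN := vdim_le hH hh y
    have e1 : N + M - vdim h z = N + M - vdim h y + 1 := by omega
    rw [e1, pow_succ] at n3
    rw [hd, pow_succ] at n2
    linear_combination (q : ℂ) * (q + 1) * n1 - ((q : ℂ) + 1) * (n2 + n3) + ((q : ℂ) + 1) * n4
  · rw [Lpmat_of_not_covers fun hcov => hzy hcov.1, mul_zero]
    by_cases hD : AttCovers h (y.ofLE (y.1 ⊓ z.1) inf_le_left) z
    · rw [sum_lower_of_covers_inf hq hd hzy hD, sum_middle_of_covers_inf hd hzy hD,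
        sum_upper_of_covers_inf hq hd hD]
      have hU := card_covers_le hq z (le_sup_right : z.1 ≤ y.1 ⊔ z.1)
      have hsum := finrank_sup_add_finrank_inf y z
      have hD2 := hD.2
      rw [show finrank F (y.1 ⊔ z.1 : Submodule F H) - vdim h z = 2 by omega] at hU
      refine mul_right_cancel₀ hq1 ?_
      split_ifs with hv
      · rw [hv, finrank_bot] at hU
        linear_combination -((q : ℂ) + 1) * hU
      · have h1 := finrank_sup_inf_eq y (y.1 ⊔ z.1)
        have h2 : finrank F (y.1 ⊔ (y.1 ⊔ z.1) ⊓ h : Submodule F H) ≤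
            finrank F (y.1 ⊔ z.1 : Submodule F H) :=
          Submodule.finrank_mono (sup_le le_sup_left inf_le_left)
        have h3 : finrank F ((y.1 ⊔ z.1) ⊓ h : Submodule F H) ≠ 0 :=
          fun h0 => hv (Submodule.finrank_eq_zero.1 h0)
        rw [show finrank F ((y.1 ⊔ z.1) ⊓ h : Submodule F H) = 1 by omega] at hU
        linear_combination -((q : ℂ) + 1) * hU
    · obtain ⟨h1, h2, h3⟩ := triple_sums_of_not_covers_inf hd hzy hD
      rw [h1, h2, h3]
      ring

end Identity

section Relations

/-- From the `R`, `L` cubic relations and the `q`-commutation with `B`, a tridiagonal relation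
for `A = R + L` and `B`. -/
theorem tridiagonal_relation {S : Type*} [Ring S] [Algebra ℂ S] {c t : ℂ} (hc : c ≠ 0)
    {R L B : S} (hRB : R * B = c • (B * R)) (hBL : B * L = c • (L * B))
    (hR : c ^ 3 • (R * R * L) - (c ^ 2 + c) • (R * L * R) + L * R * R = -(t • R))
    (hL : c ^ 3 • (R * L * L) - (c ^ 2 + c) • (L * R * L) + L * L * R = -(t • L)) :
    Commute (R + L) (c ^ 2 • ((R + L) * (R + L) * B + B * (R + L) * (R + L)) -
      (c ^ 3 + c) • ((R + L) * B * (R + L)) - ((c + 1) * t) • B) := by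
  set W : S := (c - 1) • (L * R - c ^ 2 • (R * L)) - t • 1 with hW
  have hBR : B * R = c⁻¹ • (R * B) := by rw [hRB, smul_smul, inv_mul_cancel₀ hc, one_smul]
  have h1 : W * R = c • (R * W) := by
    simp only [hW, mul_sub, sub_mul, smul_mul_assoc, mul_smul_comm, mul_one, one_mul,
      ← mul_assoc]
    linear_combination (norm := module) (c - 1) • hR
  have h2 : L * W = c • (W * L) := by
    simp only [hW, mul_sub, sub_mul, smul_mul_assoc, mul_smul_comm, mul_one, one_mul,
      ← mul_assoc]
    linear_combination (norm := module) (c - 1) • hL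
  have h3 : Commute (R + L) (W * B) := by
    change (R + L) * (W * B) = W * B * (R + L)
    rw [mul_add, mul_assoc W, mul_assoc W, hBR, hBL, add_mul, ← mul_assoc L, h2,
      mul_smul_comm, mul_smul_comm, ← mul_assoc W, h1, smul_mul_assoc, smul_mul_assoc, smul_smul,
     
      inv_mul_cancel₀ hc, one_smul]
    simp only [mul_assoc]
  have h4 : c ^ 2 • ((R + L) * (R + L) * B + B * (R + L) * (R + L)) -
      (c ^ 3 + c) • ((R + L) * B * (R + L)) - ((c + 1) * t) • B = (c + 1) • (W * B) := by
    simp only [hW, mul_add, add_mul, sub_mul, smul_mul_assoc, mul_smul_comm,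
      one_mul, mul_assoc, hBR, hBL, smul_smul]
    match_scalars <;> field_simp <;> ring
  rw [h4]
  exact h3.smul_right _

section CommutationRelations

variable {S : Type*} [Ring S] [Algebra ℂ S] {c s : ℂ} {R P K B : S}

theorem raising_cubic_of_uniform (hc : c ≠ 0) (hRK : K * R = c • (R * K)) (hKB : K * B = 1)
    (hid : c • (R * R * P) - (c + 1) • (R * P * R) + P * R * R = -(((c + 1) * s) • (B * R))) :
    c ^ 3 • (R * R * (K * P)) - (c ^ 2 + c) • (R * (K * P) * R) + K * P * R * R =
      -(((c + 1) * s) • R) := by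
  have e : R * K = c⁻¹ • (K * R) := by rw [hRK, smul_smul, inv_mul_cancel₀ hc, one_smul]
  have e' : ∀ X, R * (K * X) = c⁻¹ • (K * (R * X)) := fun X => by
    rw [← mul_assoc, e, smul_mul_assoc, mul_assoc]
  have hB : ∀ X, K * (B * X) = X := fun X => by rw [← mul_assoc, hKB, one_mul]
  have hid' := congrArg (K * ·) hid
  simp only [mul_add, mul_sub, mul_neg, mul_smul_comm, mul_assoc, hB] at hid'
  rw [← hid']
  simp only [mul_assoc, e', mul_smul_comm, smul_mul_assoc, smul_smul]
  match_scalars <;> field_simp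

theorem lowering_cubic_of_uniform (hc : c ≠ 0) (hRK : K * R = c • (R * K))
    (hPK : P * K = c • (K * P)) (hKB : K * B = 1) (hPB : B * P = c • (P * B))
    (hid : c • (R * P * P) - (c + 1) • (P * R * P) + P * P * R = -(((c + 1) * s) • (P * B))) :
    c ^ 3 • (R * (K * P) * (K * P)) - (c ^ 2 + c) • (K * P * R * (K * P)) +
      K * P * (K * P) * R = -(((c + 1) * s) • (K * P)) := by
  have e : R * K = c⁻¹ • (K * R) := by rw [hRK, smul_smul, inv_mul_cancel₀ hc, one_smul]
  have e' : ∀ X, R * (K * X) = c⁻¹ • (K * (R * X)) := fun X => by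
    rw [← mul_assoc, e, smul_mul_assoc, mul_assoc]
  have p' : ∀ X, P * (K * X) = c • (K * (P * X)) := fun X => by
    rw [← mul_assoc, hPK, smul_mul_assoc, mul_assoc]
  have hB : ∀ X, K * (B * X) = X := fun X => by rw [← mul_assoc, hKB, one_mul]
  have hPB' : P * B = c⁻¹ • (B * P) := by rw [hPB, smul_smul, inv_mul_cancel₀ hc, one_smul]
  have hid' := congrArg (fun X => c • (K * (K * X))) hid
  simp only [mul_add, mul_sub, mul_neg, mul_smul_comm, mul_assoc, hPB', hB] at hid'
  simp only [mul_assoc, e', p', mul_smul_comm, smul_mul_assoc, smul_smul] at hid' ⊢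
  have hrhs : c • -(((c + 1) * (s * c⁻¹)) • (K * P)) = -(((c + 1) * s) • (K * P)) := by
    match_scalars; field_simp
  rw [← hrhs, ← hid']
  match_scalars <;> field_simp

end CommutationRelations

end Relations

section MatrixRelations

variable {q N M : ℕ} {h : Submodule F H}

/-- The diagonal matrix with `(y,y)`-entry `q^(dim y)`. -/
def Kmat (h : Submodule F H) (q : ℕ) : Matrix (AttX h) (AttX h) ℂ :=
  Matrix.diagonal fun y => (q : ℂ) ^ vdim h y

theorem Rmat_eq_transpose : Rmat h = (Lpmat h)ᵀ := rfl

theorem Amat_eq_add : Amat h q = Rmat h + Kmat h q * Lpmat h := by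
  ext y z
  rw [Kmat, Matrix.add_apply, Matrix.diagonal_mul]
  by_cases hzy : AttCovers h z y
  · have : ¬ AttCovers h y z := fun hyz => by have := hzy.2; have := hyz.2; omega
    simp [Amat, Rmat, Lpmat, hzy, this]
  · simp [Amat, Rmat, Lpmat, hzy]

theorem Kmat_mul_Rmat : Kmat h q * Rmat h = (q : ℂ) • (Rmat h * Kmat h q) := by
  ext y z
  rw [Kmat, Matrix.smul_apply, Matrix.diagonal_mul, Matrix.mul_diagonal]
  by_cases hzy : AttCovers h z y
  · simp [Rmat, hzy, hzy.2, pow_succ']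
  · simp [Rmat, hzy]

theorem Lpmat_mul_Kmat : Lpmat h * Kmat h q = (q : ℂ) • (Kmat h q * Lpmat h) := by
  ext y z
  rw [Kmat, Matrix.smul_apply, Matrix.diagonal_mul, Matrix.mul_diagonal]
  by_cases hyz : AttCovers h y z
  · simp [Lpmat, hyz, hyz.2, pow_succ']
  · simp [Lpmat, hyz]

theorem Kmat_mul_Astar (hq0 : (q : ℂ) ≠ 0) : Kmat h q * Astar h q = 1 := by
  rw [Kmat, Astar, Matrix.diagonal_mul_diagonal, ← Matrix.diagonal_one]
  congr 1
  ext y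
  rw [_root_.zpow_neg, zpow_natCast, mul_inv_cancel₀ (pow_ne_zero _ hq0)]

theorem Rmat_mul_Astar (hq0 : (q : ℂ) ≠ 0) :
    Rmat h * Astar h q = (q : ℂ) • (Astar h q * Rmat h) := by
  ext y z
  rw [Astar, Matrix.smul_apply, Matrix.diagonal_mul, Matrix.mul_diagonal]
  by_cases hzy : AttCovers h z y
  · simp only [Rmat, hzy, hzy.2, if_true, _root_.zpow_neg, zpow_natCast, pow_succ, smul_eq_mul]
    field_simp
  · simp [Rmat, hzy]

theorem Astar_mul_Lpmat (hq0 : (q : ℂ) ≠ 0) :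
    Astar h q * Lpmat h = (q : ℂ) • (Lpmat h * Astar h q) := by
  ext y z
  rw [Astar, Matrix.smul_apply, Matrix.diagonal_mul, Matrix.mul_diagonal]
  by_cases hyz : AttCovers h y z
  · simp only [Lpmat, hyz, hyz.2, if_true, _root_.zpow_neg, zpow_natCast, pow_succ, smul_eq_mul]
    field_simp
  · simp [Lpmat, hyz]

theorem Astar_mul_Lmat (hq0 : (q : ℂ) ≠ 0) :
    Astar h q * (Kmat h q * Lpmat h) = (q : ℂ) • (Kmat h q * Lpmat h * Astar h q) := by
  have hcomm : Astar h q * Kmat h q = Kmat h q * Astar h q := by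
    simp only [Kmat, Astar, Matrix.diagonal_mul_diagonal, mul_comm]
  rw [← mul_assoc, hcomm, mul_assoc, Astar_mul_Lpmat hq0, mul_smul_comm, mul_assoc]

theorem uniform_identity (hq : Fintype.card F = q) (hH : finrank F H = N + M)
    (hh : finrank F h = M) :
    (q : ℂ) • (Rmat h * Rmat h * Lpmat h) - ((q : ℂ) + 1) • (Rmat h * Lpmat h * Rmat h) +
      Lpmat h * Rmat h * Rmat h =
    -((((q : ℂ) + 1) * (q : ℂ) ^ (N + M)) • (Astar h q * Rmat h)) := by
  have hq0 : (q : ℂ) ≠ 0 := by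
    exact_mod_cast (zero_lt_one.trans (one_lt_of_card_eq hq)).ne'
  ext y z
  have e1 : (Rmat h * Rmat h * Lpmat h) y z =
      ∑ a, Lpmat h a z * ∑ b, Lpmat h a b * Lpmat h b y := by
    simp only [Matrix.mul_apply, Rmat_eq_transpose, Matrix.transpose_apply]
    exact sum_congr rfl fun a _ => by rw [mul_comm]; simp only [mul_comm]
  have e2 : (Rmat h * Lpmat h * Rmat h) y z =
      ∑ a, Lpmat h z a * ∑ b, Lpmat h b a * Lpmat h b y := by
    simp only [Matrix.mul_apply, Rmat_eq_transpose, Matrix.transpose_apply]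
    exact sum_congr rfl fun a _ => by rw [mul_comm]; simp only [mul_comm]
  have e3 : (Lpmat h * Rmat h * Rmat h) y z =
      ∑ b, Lpmat h y b * ∑ a, Lpmat h z a * Lpmat h a b := by
    rw [mul_assoc, Matrix.mul_apply]
    simp only [Matrix.mul_apply, Rmat_eq_transpose, Matrix.transpose_apply, mul_comm]
  have e4 : (Astar h q * Rmat h) y z = (q : ℂ) ^ (-(vdim h y : ℤ)) * Lpmat h z y := by
    rw [Astar, Matrix.diagonal_mul]; rfl
  simp only [Matrix.add_apply, Matrix.sub_apply, Matrix.smul_apply, Matrix.neg_apply, smul_eq_mul,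
    e1, e2, e3, e4]
  by_cases hd : vdim h y = vdim h z + 1
  · rw [triple_sum_identity hq hH hh hd]
    have hyN := vdim_le hH hh y
    have hpow : (q : ℂ) ^ (N + M) = (q : ℂ) ^ (N + M - vdim h y) * (q : ℂ) ^ vdim h y := by
      rw [← pow_add]; congr 1; omega
    rw [_root_.zpow_neg, zpow_natCast, hpow]
    field_simp
  · rw [Lpmat_of_not_covers fun hcov => hd hcov.2]
    have z1 : ∑ a, Lpmat h a z * ∑ b, Lpmat h a b * Lpmat h b y = 0 := by
      simp only [mul_sum]
      refine sum_eq_zero fun a _ => sum_eq_zero fun b _ => ?_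
      by_contra hne
      have h1 := (covers_of_Lpmat_ne_zero (left_ne_zero_of_mul hne)).2
      have h2 := (covers_of_Lpmat_ne_zero (left_ne_zero_of_mul (right_ne_zero_of_mul hne))).2
      have h3 := (covers_of_Lpmat_ne_zero (right_ne_zero_of_mul (right_ne_zero_of_mul hne))).2
      omega
    have z2 : ∑ a, Lpmat h z a * ∑ b, Lpmat h b a * Lpmat h b y = 0 := by
      simp only [mul_sum]
      refine sum_eq_zero fun a _ => sum_eq_zero fun b _ => ?_
      by_contra hne
      have h1 := (covers_of_Lpmat_ne_zero (left_ne_zero_of_mul hne)).2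
      have h2 := (covers_of_Lpmat_ne_zero (left_ne_zero_of_mul (right_ne_zero_of_mul hne))).2
      have h3 := (covers_of_Lpmat_ne_zero (right_ne_zero_of_mul (right_ne_zero_of_mul hne))).2
      omega
    have z3 : ∑ b, Lpmat h y b * ∑ a, Lpmat h z a * Lpmat h a b = 0 := by
      simp only [mul_sum]
      refine sum_eq_zero fun a _ => sum_eq_zero fun b _ => ?_
      by_contra hne
      have h1 := (covers_of_Lpmat_ne_zero (left_ne_zero_of_mul hne)).2
      have h2 := (covers_of_Lpmat_ne_zero (left_ne_zero_of_mul (right_ne_zero_of_mul hne))).2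
      have h3 := (covers_of_Lpmat_ne_zero (right_ne_zero_of_mul (right_ne_zero_of_mul hne))).2
      omega
    rw [z1, z2, z3]
    ring

theorem uniform_identity_transpose (hq : Fintype.card F = q) (hH : finrank F H = N + M)
    (hh : finrank F h = M) :
    (q : ℂ) • (Rmat h * Lpmat h * Lpmat h) - ((q : ℂ) + 1) • (Lpmat h * Rmat h * Lpmat h) +
      Lpmat h * Lpmat h * Rmat h =
    -((((q : ℂ) + 1) * (q : ℂ) ^ (N + M)) • (Lpmat h * Astar h q)) := by
  have hT := congrArg Matrix.transpose (uniform_identity (N := N) hq hH hh)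
  have hA : (Astar h q)ᵀ = Astar h q := Matrix.diagonal_transpose _
  simpa only [Matrix.transpose_add, Matrix.transpose_sub, Matrix.transpose_neg,
    Matrix.transpose_smul, Matrix.transpose_mul, Rmat_eq_transpose, Matrix.transpose_transpose, hA,
    mul_assoc] using hT

/-- The tridiagonal relation satisfied by `A` and `A*`. -/
theorem commute_Amat (hq : Fintype.card F = q) (hH : finrank F H = N + M)
    (hh : finrank F h = M) :
    Commute (Amat h q) ((q : ℂ) ^ 2 • (Amat h q * Amat h q * Astar h q +
        Astar h q * Amat h q * Amat h q) -
      ((q : ℂ) ^ 3 + q) • (Amat h q * Astar h q * Amat h q) -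
      (((q : ℂ) + 1) * (((q : ℂ) + 1) * (q : ℂ) ^ (N + M))) • Astar h q) := by
  have hq0 : (q : ℂ) ≠ 0 := by
    exact_mod_cast (zero_lt_one.trans (one_lt_of_card_eq hq)).ne'
  rw [Amat_eq_add]
  exact tridiagonal_relation hq0 (Rmat_mul_Astar hq0) (Astar_mul_Lmat hq0)
    (raising_cubic_of_uniform hq0 Kmat_mul_Rmat (Kmat_mul_Astar hq0)
      (uniform_identity hq hH hh))
    (lowering_cubic_of_uniform hq0 Kmat_mul_Rmat Lpmat_mul_Kmat (Kmat_mul_Astar hq0)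
      (Astar_mul_Lpmat hq0) (uniform_identity_transpose hq hH hh))

end MatrixRelations

section Eigenspaces

/-- A vector killed by a product of three distinct linear factors is a sum of eigenvectors. -/
theorem mem_sup_eigenspace_of_cubic {V : Type*} [AddCommGroup V] [Module ℂ V]
    {f : Module.End ℂ V} {a b c : ℂ} (hab : a ≠ b) (hac : a ≠ c) (hbc : b ≠ c) {w : V}
    (hw : f (f (f w)) = (a + b + c) • f (f w) - (a * b + b * c + a * c) • f w + (a * b * c) • w) :
    w ∈ f.eigenspace a ⊔ f.eigenspace b ⊔ f.eigenspace c := by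
  have h1 := sub_ne_zero.2 hab
  have h2 := sub_ne_zero.2 hac
  have h3 := sub_ne_zero.2 hbc
  have hdecomp : w = ((a - b) * (a - c))⁻¹ • (f (f w) - (b + c) • f w + (b * c) • w) +
      (-((a - b) * (b - c))⁻¹) • (f (f w) - (a + c) • f w + (a * c) • w) +
      ((a - c) * (b - c))⁻¹ • (f (f w) - (a + b) • f w + (a * b) • w) := by
    match_scalars <;> field_simp <;> ring
  rw [hdecomp]
  refine Submodule.add_mem_sup (Submodule.add_mem_sup ?_ ?_) ?_ <;>
  · refine Submodule.smul_mem _ _ (Module.End.mem_eigenspace_iff.2 ?_)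
    simp only [map_add, map_sub, map_smul, hw]
    module

theorem apply_mem_sup_eigenspace {V : Type*} [AddCommGroup V] [Module ℂ V]
    {f g : Module.End ℂ V} {c ρ θ θ₁ θ₂ : ℂ} (hc : c ≠ 0)
    (hfg : Commute f (c ^ 2 • (f * f * g + g * f * f) - (c ^ 3 + c) • (f * g * f) - ρ • g))
    (h1 : θ₁ ≠ θ) (h2 : θ ≠ θ₂) (h12 : θ₁ ≠ θ₂) (hsum : c ^ 2 * (θ₁ + θ₂) = (c ^ 3 + c) * θ)
    (hprod : c ^ 2 * (θ₁ * θ₂) = c ^ 2 * θ ^ 2 - ρ) {v : V} (hv : v ∈ f.eigenspace θ) :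
    g v ∈ f.eigenspace θ₁ ⊔ f.eigenspace θ ⊔ f.eigenspace θ₂ := by
  have hfv : f v = θ • v := Module.End.mem_eigenspace_iff.1 hv
  refine mem_sup_eigenspace_of_cubic h1 h12 h2 ?_
  have key := LinearMap.congr_fun hfg.eq v
  simp only [Module.End.mul_apply, LinearMap.sub_apply, LinearMap.add_apply, LinearMap.smul_apply,
    map_sub, map_add, map_smul, hfv] at key
  have hsum' : θ₁ + θ₂ = (c ^ 2)⁻¹ * ((c ^ 3 + c) * θ) := by rw [← hsum]; field_simp
  have hprod' : θ₁ * θ₂ = (c ^ 2)⁻¹ * (c ^ 2 * θ ^ 2 - ρ) := by rw [← hprod]; field_simp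
  have e1 : θ₁ + θ + θ₂ = (c ^ 2)⁻¹ * ((c ^ 3 + c) * θ) + θ := by rw [← hsum']; ring
  have e2 : θ₁ * θ + θ * θ₂ + θ₁ * θ₂ =
      (c ^ 2)⁻¹ * ((c ^ 3 + c) * θ) * θ + (c ^ 2)⁻¹ * (c ^ 2 * θ ^ 2 - ρ) := by
    rw [← hsum', ← hprod']; ring
  have e3 : θ₁ * θ * θ₂ = (c ^ 2)⁻¹ * (c ^ 2 * θ ^ 2 - ρ) * θ := by rw [← hprod']; ring
  rw [e1, e2, e3]
  have hc2 : c ^ 2 ≠ 0 := pow_ne_zero 2 hc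
  have key' := congrArg ((c ^ 2)⁻¹ • ·) (sub_eq_zero.2 key)
  rw [smul_zero] at key'
  rw [← sub_eq_zero, ← key']
  match_scalars <;> field_simp <;> ring

/-- The eigenvalue `θ_(j/2)` for an arbitrary integer `j`, with `s = √q`. -/
def thetaInt (s : ℝ) (N M : ℕ) (j : ℤ) : ℝ :=
  (s ^ (2 * (N : ℤ) - j) - s ^ j) / (s ^ 2 - 1) * s ^ M

section ThetaInt

variable {s : ℝ} {N M : ℕ}

theorem thetaInt_strictAnti (hs : 1 < s) : StrictAnti (thetaInt s N M) := by
  intro i j hij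
  have h1 : s ^ i < s ^ j := zpow_lt_zpow_right₀ hs hij
  have h2 : s ^ (2 * (N : ℤ) - j) < s ^ (2 * (N : ℤ) - i) := zpow_lt_zpow_right₀ hs (by omega)
  have h3 : 0 < s ^ 2 - 1 := by nlinarith
  have h4 : 0 < s ^ M := by positivity
  unfold thetaInt
  gcongr

theorem thetaInt_reflect (j : ℤ) : thetaInt s N M (2 * N - j) = -thetaInt s N M j := by
  unfold thetaInt
  rw [sub_sub_cancel]
  ring

theorem zpow_reflect_shift (hs0 : s ≠ 0) (j : ℤ) :
    s ^ (2 * (N : ℤ) - (j - 2)) = s ^ (2 * (N : ℤ) - j) * s ^ 2 ∧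
      s ^ (2 * (N : ℤ) - (j + 2)) = s ^ (2 * (N : ℤ) - j) / s ^ 2 ∧
      s ^ (j - 2) = s ^ j / s ^ 2 ∧ s ^ (j + 2) = s ^ j * s ^ 2 := by
  have hadd (m : ℤ) : s ^ (m + 2) = s ^ m * s ^ 2 := zpow_add₀ hs0 m 2
  have hsub (m : ℤ) : s ^ (m - 2) = s ^ m / s ^ 2 := zpow_sub₀ hs0 m 2
  refine ⟨?_, ?_, hsub j, hadd j⟩
  · rw [← hadd]; congr 1; ring
  · rw [← hsub]; congr 1; ring

theorem thetaInt_sum (hs : 1 < s) (j : ℤ) :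
    (s ^ 2) ^ 2 * (thetaInt s N M (j - 2) + thetaInt s N M (j + 2)) =
      ((s ^ 2) ^ 3 + s ^ 2) * thetaInt s N M j := by
  have hs0 : s ≠ 0 := by positivity
  have h3 : s ^ 2 - 1 ≠ 0 := by nlinarith
  obtain ⟨h4, h5, h6, h7⟩ := zpow_reflect_shift (N := N) hs0 j
  unfold thetaInt
  rw [h4, h5, h6, h7]
  generalize s ^ (2 * (N : ℤ) - j) = x
  generalize s ^ j = y
  field_simp
  ring

theorem thetaInt_prod (hs : 1 < s) (j : ℤ) :
    (s ^ 2) ^ 2 * (thetaInt s N M (j - 2) * thetaInt s N M (j + 2)) =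
      (s ^ 2) ^ 2 * thetaInt s N M j ^ 2 -
        (s ^ 2 + 1) * ((s ^ 2 + 1) * (s ^ 2) ^ (N + M)) := by
  have hs0 : s ≠ 0 := by positivity
  have h3 : s ^ 2 - 1 ≠ 0 := by nlinarith
  have hxy : s ^ (2 * (N : ℤ) - j) * s ^ j = (s ^ 2) ^ N := by
    rw [← zpow_add₀ hs0, ← pow_mul, ← zpow_natCast]
    congr 1
    push_cast
    ring
  obtain ⟨h4, h5, h6, h7⟩ := zpow_reflect_shift (N := N) hs0 j
  unfold thetaInt
  rw [h4, h5, h6, h7, pow_add, ← hxy, ← pow_mul s 2 M, mul_comm 2 M, pow_mul]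
  generalize s ^ (2 * (N : ℤ) - j) = x
  generalize s ^ j = y
  generalize s ^ M = g
  field_simp
  ring

end ThetaInt

section Spectrum

variable {q N M : ℕ} {h : Submodule F H}

theorem one_lt_sqrt_of_card (hq : Fintype.card F = q) : 1 < Real.sqrt q := by
  rw [Real.lt_sqrt zero_le_one, one_pow]
  exact_mod_cast one_lt_of_card_eq hq

theorem theta_eq_thetaInt {k : ℕ} (hk : k ≤ 2 * N) :
    theta q N M k = thetaInt (Real.sqrt q) N M k := by
  unfold theta thetaInt
  rw [Real.sq_sqrt (Nat.cast_nonneg q), ← zpow_natCast _ (2 * N - k), Nat.cast_sub hk]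
  push_cast
  simp

/-- The eigenspace of `A` for `θ_(j/2)`, `j` an arbitrary integer. -/
def eigInt (h : Submodule F H) (q N M : ℕ) (j : ℤ) : Submodule ℂ (AttX h → ℂ) :=
  Module.End.eigenspace (Matrix.toLin' (Amat h q)) ((thetaInt (Real.sqrt q) N M j : ℝ) : ℂ)

theorem eigA_eq_eigInt {k : ℕ} (hk : k ≤ 2 * N) : eigA h q N M k = eigInt h q N M k := by
  rw [eigA, eigInt, theta_eq_thetaInt hk]

theorem Astar_mulVec_mem (hq : Fintype.card F = q) (hH : finrank F H = N + M)
    (hh : finrank F h = M) {j : ℤ} {v : AttX h → ℂ} (hv : v ∈ eigInt h q N M j) :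
    Matrix.toLin' (Astar h q) v ∈
      eigInt h q N M (j - 2) ⊔ eigInt h q N M j ⊔ eigInt h q N M (j + 2) := by
  have hs := one_lt_sqrt_of_card hq
  have hanti := thetaInt_strictAnti (N := N) (M := M) hs
  have hq0 : (q : ℂ) ≠ 0 := by
    exact_mod_cast (zero_lt_one.trans (one_lt_of_card_eq hq)).ne'
  have hsum := thetaInt_sum (N := N) (M := M) hs j
  have hprod := thetaInt_prod (N := N) (M := M) hs j
  rw [Real.sq_sqrt (Nat.cast_nonneg q)] at hsum hprod
  have hcomm := (commute_Amat (N := N) hq hH hh).map (Matrix.toLinAlgEquiv' (R := ℂ))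
  simp only [map_sub, map_add, map_smul, map_mul] at hcomm
  refine apply_mem_sup_eigenspace hq0 hcomm ?_ ?_ ?_ ?_ ?_ hv
  · exact_mod_cast (hanti (by omega : j - 2 < j)).ne'
  · exact_mod_cast (hanti (by omega : j < j + 2)).ne'
  · exact_mod_cast (hanti (by omega : j - 2 < j + 2)).ne'
  · exact_mod_cast hsum
  · exact_mod_cast hprod

/-- The vector with `y`-entry `q^(-M dim y/2)` is an eigenvector of `A` for `θ_0`. -/
theorem Amat_row_sum (hq : Fintype.card F = q) (hH : finrank F H = N + M)
    (hh : finrank F h = M) (y : AttX h) :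
    ∑ z, ‖Amat h q y z‖ * (Real.sqrt q ^ M)⁻¹ ^ vdim h z =
      thetaInt (Real.sqrt q) N M 0 * (Real.sqrt q ^ M)⁻¹ ^ vdim h y := by
  have hs := one_lt_sqrt_of_card hq
  have hs2 : Real.sqrt q ^ 2 = q := Real.sq_sqrt (Nat.cast_nonneg q)
  set g : ℝ := Real.sqrt q ^ M with hg
  have hg0 : g ≠ 0 := by positivity
  have hg2 : g * g = (q : ℝ) ^ M := by
    rw [hg, ← mul_pow, ← pow_two, hs2]
  have hq1 : (q : ℝ) - 1 ≠ 0 := sub_ne_zero.2 (by exact_mod_cast (one_lt_of_card_eq hq).ne')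
  have hterm : ∀ z, ‖Amat h q y z‖ * g⁻¹ ^ vdim h z =
      (g * (if AttCovers h z y then (1 : ℝ) else 0) +
        (q : ℝ) ^ vdim h y * g⁻¹ * (if AttCovers h y z then (1 : ℝ) else 0)) * g⁻¹ ^ vdim h y := by
    intro z
    by_cases hzy : AttCovers h z y
    · have hyz : ¬ AttCovers h y z := fun hyz => by have := hzy.2; have := hyz.2; omega
      simp only [Amat, hzy, hyz, if_true, if_false, norm_one, hzy.2, pow_succ]
      field_simp
      ring
    · by_cases hyz : AttCovers h y z
      · simp only [Amat, hzy, hyz, if_true, if_false, norm_pow, Complex.norm_natCast, hyz.2,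
          pow_succ]
        ring
      · simp [Amat, hzy, hyz]
  have hn : (∑ z, if AttCovers h z y then (1 : ℝ) else 0) * ((q : ℝ) - 1) =
      (q : ℝ) ^ vdim h y - 1 := by
    have := sum_lower hq y
    simp only [Lpmat] at this
    exact_mod_cast this
  have hc : (∑ z, if AttCovers h y z then (1 : ℝ) else 0) * ((q : ℝ) - 1) =
      (q : ℝ) ^ (N + M - vdim h y) - (q : ℝ) ^ M := by
    have := sum_upper hq hH hh y
    simp only [Lpmat] at this
    exact_mod_cast this
  rw [sum_congr rfl fun z _ => hterm z, ← sum_mul, sum_add_distrib, ← mul_sum, ← mul_sum]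
  congr 1
  refine mul_right_cancel₀ hq1 ?_
  have hθ : thetaInt (Real.sqrt q) N M 0 * ((q : ℝ) - 1) = ((q : ℝ) ^ N - 1) * g := by
    unfold thetaInt
    have : Real.sqrt q ^ (2 * (N : ℤ) - 0) = (q : ℝ) ^ N := by
      have h2 : Real.sqrt q ^ (2 * (N : ℤ)) = Real.sqrt q ^ (2 * N) :=
        zpow_natCast (Real.sqrt q) (2 * N)
      rw [sub_zero, h2, pow_mul, hs2]
    rw [this, hs2, zpow_zero, ← hg]
    field_simp
  have hyN := vdim_le hH hh y
  have hpow : (q : ℝ) ^ vdim h y * (q : ℝ) ^ (N + M - vdim h y) = (q : ℝ) ^ N * (g * g) := by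
    rw [hg2, ← pow_add, ← pow_add]; congr 1; omega
  have hgg : g⁻¹ * (g * g) = g := by field_simp
  rw [hθ]
  linear_combination g * hn + (q : ℝ) ^ vdim h y * g⁻¹ * hc + g⁻¹ * hpow +
    (q : ℝ) ^ vdim h y * g⁻¹ * hg2 + ((q : ℝ) ^ N - (q : ℝ) ^ vdim h y) * hgg

/-- Every eigenvalue of `A` is bounded by its Perron eigenvalue `θ_0`. -/
theorem norm_le_of_mulVec_eq (hq : Fintype.card F = q) (hH : finrank F H = N + M)
    (hh : finrank F h = M) {μ : ℂ} {v : AttX h → ℂ} (hv0 : v ≠ 0)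
    (hv : Amat h q *ᵥ v = μ • v) : ‖μ‖ ≤ thetaInt (Real.sqrt q) N M 0 := by
  have hs := one_lt_sqrt_of_card hq
  set u : AttX h → ℝ := fun z => (Real.sqrt q ^ M)⁻¹ ^ vdim h z with hu
  have hupos : ∀ z, 0 < u z := fun z => by positivity
  obtain ⟨x, hx⟩ := Function.ne_iff.1 hv0
  obtain ⟨y, -, hy⟩ := Finset.exists_max_image univ (fun z => ‖v z‖ / u z) ⟨x, mem_univ x⟩
  have hypos : 0 < ‖v y‖ := by
    have h1 : 0 < ‖v x‖ / u x := div_pos (norm_pos_iff.2 hx) (hupos x)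
    have h2 := h1.trans_le (hy x (mem_univ x))
    exact (div_pos_iff_of_pos_right (hupos y)).1 h2
  refine le_of_mul_le_mul_right ?_ hypos
  calc ‖μ‖ * ‖v y‖ = ‖∑ z, Amat h q y z * v z‖ := by
        rw [← norm_mul]
        exact congrArg norm (congrFun hv y).symm
    _ ≤ ∑ z, ‖Amat h q y z‖ * ‖v z‖ :=
        (norm_sum_le _ _).trans_eq (sum_congr rfl fun z _ => norm_mul _ _)
    _ ≤ ∑ z, ‖Amat h q y z‖ * (‖v y‖ / u y * u z) := by
        refine sum_le_sum fun z _ => mul_le_mul_of_nonneg_left ?_ (norm_nonneg _)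
        exact (div_le_iff₀ (hupos z)).1 (hy z (mem_univ z))
    _ = ‖v y‖ / u y * ∑ z, ‖Amat h q y z‖ * u z := by
        rw [mul_sum]
        exact sum_congr rfl fun z _ => by ring
    _ = thetaInt (Real.sqrt q) N M 0 * ‖v y‖ := by
        rw [Amat_row_sum hq hH hh y]
        have := (hupos y).ne'
        change _ / u y * (_ * u y) = _
        field_simp

theorem eigInt_eq_bot (hq : Fintype.card F = q) (hH : finrank F H = N + M)
    (hh : finrank F h = M) {j : ℤ} (hj : j < 0 ∨ 2 * (N : ℤ) < j) : eigInt h q N M j = ⊥ := by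
  have hanti := thetaInt_strictAnti (N := N) (M := M) (one_lt_sqrt_of_card hq)
  refine (Submodule.eq_bot_iff _).2 fun v hv => ?_
  by_contra hv0
  have hle := norm_le_of_mulVec_eq hq hH hh hv0 (Module.End.mem_eigenspace_iff.1 hv)
  rw [Complex.norm_real, Real.norm_eq_abs, abs_le] at hle
  rcases hj with hj | hj
  · exact absurd hle.2 (hanti hj).not_ge
  · have h1 := hanti hj
    have h2 := thetaInt_reflect (s := Real.sqrt q) (N := N) (M := M) 0
    rw [sub_zero] at h2
    rw [h2] at h1
    exact absurd hle.1 h1.not_ge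

end Spectrum

section Ordering

variable {q N M : ℕ} {h : Submodule F H}

theorem Vord_eq_of_le {k : ℤ} (h0 : 0 ≤ k) (hk : k ≤ N) :
    Vord h q N M k = eigInt h q N M (2 * k) := by
  rw [Vord, if_pos ⟨h0, hk⟩, eigA_eq_eigInt (by omega)]
  congr 1
  omega

theorem Vord_eq_of_lt {k : ℤ} (h0 : (N : ℤ) < k) (hk : k ≤ 2 * N) :
    Vord h q N M k = eigInt h q N M (2 * (k - N) - 1) := by
  rw [Vord, if_neg (by omega), if_pos ⟨h0, hk⟩, eigA_eq_eigInt (by omega)]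
  congr 1
  omega

theorem eigInt_le_Vord_even (hq : Fintype.card F = q) (hH : finrank F H = N + M)
    (hh : finrank F h = M) (k : ℤ) :
    eigInt h q N M (2 * k) ≤ Vord h q N M k := by
  by_cases hk' : 0 ≤ k ∧ k ≤ N
  · exact (Vord_eq_of_le hk'.1 hk'.2).ge
  · rw [eigInt_eq_bot hq hH hh (by omega)]
    exact bot_le

theorem eigInt_le_Vord_odd (hq : Fintype.card F = q) (hH : finrank F H = N + M)
    (hh : finrank F h = M) (k : ℤ) :
    eigInt h q N M (2 * (k - N) - 1) ≤ Vord h q N M k := by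
  by_cases hk' : (N : ℤ) < k ∧ k ≤ 2 * N
  · exact (Vord_eq_of_lt hk'.1 hk'.2).ge
  · rw [eigInt_eq_bot hq hH hh (by omega)]
    exact bot_le

theorem map_Astar_Vord_le (hq : Fintype.card F = q) (hH : finrank F H = N + M)
    (hh : finrank F h = M) {k : ℤ} (h0 : 0 ≤ k) (hk : k ≤ 2 * (N : ℤ)) :
    Submodule.map (Matrix.toLin' (Astar h q)) (Vord h q N M k)
      ≤ Vord h q N M (k - 1) ⊔ Vord h q N M k ⊔ Vord h q N M (k + 1) := by
  rw [Submodule.map_le_iff_le_comap]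
  intro v hv
  rcases le_or_gt k N with hkN | hkN
  · rw [Vord_eq_of_le h0 hkN] at hv
    refine SetLike.le_def.1 (sup_le_sup (sup_le_sup ?_ ?_) ?_) (Astar_mulVec_mem hq hH hh hv)
    · rw [show 2 * k - 2 = 2 * (k - 1) by ring]
      exact eigInt_le_Vord_even hq hH hh _
    · exact eigInt_le_Vord_even hq hH hh _
    · rw [show 2 * k + 2 = 2 * (k + 1) by ring]
      exact eigInt_le_Vord_even hq hH hh _
  · rw [Vord_eq_of_lt hkN hk] at hv
    refine SetLike.le_def.1 (sup_le_sup (sup_le_sup ?_ ?_) ?_) (Astar_mulVec_mem hq hH hh hv)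
    · rw [show 2 * (k - N) - 1 - 2 = 2 * (k - 1 - N) - 1 by ring]
      exact eigInt_le_Vord_odd hq hH hh _
    · exact eigInt_le_Vord_odd hq hH hh _
    · rw [show 2 * (k - N) - 1 + 2 = 2 * (k + 1 - N) - 1 by ring]
      exact eigInt_le_Vord_odd hq hH hh _

end Ordering

end Eigenspaces

section DualAdjacencyAlgebra

variable {q N M : ℕ} {h : Submodule F H}

theorem aeval_diagonal {n : Type*} [Fintype n] [DecidableEq n] (d : n → ℂ)
    (p : Polynomial ℂ) :
    Polynomial.aeval (Matrix.diagonal d) p = Matrix.diagonal fun y => p.eval (d y) := by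
  have h1 := Polynomial.aeval_algHom_apply (Matrix.diagonalAlgHom (n := n) (α := ℂ) ℂ) d p
  rw [Polynomial.aeval_pi_apply] at h1
  simpa using h1

theorem diagonal_eq_sum_Estar (hN : ∀ y : AttX h, vdim h y ≤ N) (f : ℕ → ℂ) :
    (Matrix.diagonal fun y : AttX h => f (vdim h y)) =
      ∑ i ∈ range (N + 1), f i • Estar h i := by
  ext y z
  rw [Matrix.sum_apply]
  by_cases hyz : y = z
  · subst hyz
    simp [Estar, Nat.lt_succ_of_le (hN y)]
  · simp [Estar, hyz]

theorem adjoin_Astar (hq : Fintype.card F = q) (hH : finrank F H = N + M)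
    (hh : finrank F h = M) :
    Subalgebra.toSubmodule (Algebra.adjoin ℂ {Astar h q})
      = Submodule.span ℂ {m : Matrix (AttX h) (AttX h) ℂ | ∃ i ≤ N, m = Estar h i} := by
  have hN := vdim_le hH hh
  refine le_antisymm ?_ (Submodule.span_le.2 ?_)
  · intro x hx
    rw [Subalgebra.mem_toSubmodule, Algebra.adjoin_singleton_eq_range_aeval] at hx
    obtain ⟨p, rfl⟩ := hx
    change Polynomial.aeval (Astar h q) p ∈ _
    rw [Astar, aeval_diagonal,
      diagonal_eq_sum_Estar hN fun i => p.eval ((q : ℂ) ^ (-(i : ℤ)))]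
    exact Submodule.sum_mem _ fun i hi => Submodule.smul_mem _ _
      (Submodule.subset_span ⟨i, Nat.lt_succ_iff.1 (mem_range.1 hi), rfl⟩)
  · rintro _ ⟨i, hi, rfl⟩
    have hq1 := one_lt_of_card_eq hq
    have hinj : Set.InjOn (fun i : ℕ => (q : ℂ) ^ (-(i : ℤ))) (range (N + 1)) := by
      intro a _ b _ hab
      simp only [_root_.zpow_neg, zpow_natCast, _root_.inv_inj] at hab
      exact Nat.pow_right_injective hq1 (by exact_mod_cast hab)
    have hi' : i ∈ range (N + 1) := mem_range.2 (Nat.lt_succ_of_le hi)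
    have hE : Estar h i = Polynomial.aeval (Astar h q)
        (Lagrange.basis (range (N + 1)) (fun i : ℕ => (q : ℂ) ^ (-(i : ℤ))) i) := by
      rw [Astar, aeval_diagonal, Estar]
      congr 1
      ext y
      split_ifs with hy
      · rw [hy, Lagrange.eval_basis_self hinj hi']
      · exact (Lagrange.eval_basis_of_ne (v := fun i : ℕ => (q : ℂ) ^ (-(i : ℤ))) (Ne.symm hy)
          (mem_range.2 (Nat.lt_succ_of_le (hN y)))).symm
    rw [hE, SetLike.mem_coe, Subalgebra.mem_toSubmodule, Algebra.adjoin_singleton_eq_range_aeval]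
    exact ⟨_, rfl⟩

end DualAdjacencyAlgebra

/-- `A*` is a dual adjacency matrix for the ordering
`V_0 = eig(θ_0), …, V_N = eig(θ_N), V_(N+1) = eig(θ_(1/2)), …, V_(2N) = eig(θ_(N-1/2))`
of the eigenspaces of `A`: (a) the unital `ℂ`-subalgebra generated by `A*` is the span of
`E*_0, …, E*_N`, and (b) `A* V_k ⊆ V_(k-1) + V_k + V_(k+1)` for `0 ≤ k ≤ 2N` (with
`V_(-1) = V_(2N+1) = 0`).  In particular this ordering is `Q`-polynomial, so the
`q`-adjacency matrix `A` is `Q`-polynomial. -/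
theorem stmt18 (q N M : ℕ) (hq : Fintype.card F = q) (hN : 0 < N) (hM : 0 < M)
    (h : Submodule F H) (hH : finrank F H = N + M) (hh : finrank F h = M) :
    Subalgebra.toSubmodule (Algebra.adjoin ℂ {Astar h q})
      = Submodule.span ℂ {m : Matrix (AttX h) (AttX h) ℂ | ∃ i ≤ N, m = Estar h i} ∧
    (∀ k : ℤ, 0 ≤ k → k ≤ 2 * (N : ℤ) →
      Submodule.map (Matrix.toLin' (Astar h q)) (Vord h q N M k)
        ≤ Vord h q N M (k - 1) ⊔ Vord h q N M k ⊔ Vord h q N M (k + 1)) := by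
  exact ⟨adjoin_Astar hq hH hh, fun k h0 hk => map_Astar_Vord_le hq hH hh h0 hk⟩
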